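/- arXiv:2601.10163 — 4 statements merged into one kernel-verified Lean document; each statement's English description precedes it below -/
import Mathlib

section
/- Let r be a positive integer and let G be a connected simple graph with m edges, where m ≥ (9r)², such that G is B_{r+1}-free (every two adjacent vertices of G have at most r common neighbors). Then the spectral radius satisfies ρ(G) ≤ √m, and equality ρ(G) = √m holds if and only if G is a complete bipartite graph. -/
open Classical in
/-- The (classical) real adjacency matrix of a simple graph. -/
noncomputable def adjMat {V : Type*} (G : SimpleGraph V) : Matrix V V ℝ :=
  Matrix.of fun i j => if G.Adj i j then (1 : ℝ) else 0

theorem adjMat_isHermitian {V : Type*} (G : SimpleGraph V) :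
    (adjMat G).IsHermitian := by
  classical
  unfold Matrix.IsHermitian
  ext i j
  simp only [Matrix.conjTranspose_apply, adjMat, Matrix.of_apply, star_trivial]
  by_cases h : G.Adj i j
  · simp [h, h.symm]
  · have h' : ¬ G.Adj j i := fun hh => h hh.symm
    simp [h, h']

/-- The spectral radius of a finite simple graph: the largest eigenvalue of its
adjacency matrix. -/
noncomputable def specRad {V : Type*} [Fintype V] [DecidableEq V] (G : SimpleGraph V) : ℝ :=
  ⨆ i, (adjMat_isHermitian G).eigenvalues i

/-- A graph is complete bipartite iff there is a set `S` of vertices such that the edges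
are exactly the pairs joining `S` to its complement. -/
def IsCompleteBipartite {V : Type*} (G : SimpleGraph V) : Prop :=
  ∃ S : Set V, ∀ u v, G.Adj u v ↔ ((u ∈ S ∧ v ∉ S) ∨ (u ∉ S ∧ v ∈ S))

theorem adjMat_eq_one_iff {V : Type*} (G : SimpleGraph V) (u v : V) :
    adjMat G u v = 1 ↔ G.Adj u v := by
  simp [adjMat]

theorem adjMat_eq_zero_iff {V : Type*} (G : SimpleGraph V) (u v : V) :
    adjMat G u v = 0 ↔ ¬ G.Adj u v := by
  simp [adjMat]

theorem adjMat_eq_zero_or_one {V : Type*} (G : SimpleGraph V) (u v : V) :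
    adjMat G u v = 0 ∨ adjMat G u v = 1 := by
  rw [adjMat_eq_one_iff, adjMat_eq_zero_iff]
  exact (em _).symm

theorem adjMat_nonneg {V : Type*} (G : SimpleGraph V) (u v : V) : 0 ≤ adjMat G u v := by
  rcases adjMat_eq_zero_or_one G u v with h | h <;> simp [h]

theorem adjMat_comm {V : Type*} (G : SimpleGraph V) (u v : V) :
    adjMat G u v = adjMat G v u := by
  by_cases h : G.Adj u v <;> simp [adjMat, h, G.adj_comm v u]

theorem sum_adjMat {V : Type*} [Fintype V] (G : SimpleGraph V) :
    ∑ u, ∑ v, adjMat G u v = 2 * (G.edgeSet.ncard : ℝ) := by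
  classical
  have h : ∀ u, ∑ v, adjMat G u v = (G.degree u : ℝ) := fun u => by
    simp [adjMat, ← SimpleGraph.card_neighborFinset_eq_degree, SimpleGraph.neighborFinset_eq_filter]
  rw [Finset.sum_congr rfl fun u _ => h u, Set.ncard_eq_toFinset_card']
  exact_mod_cast G.sum_degrees_eq_twice_card_edges

theorem sum_adjMat_mul_adjMat {V : Type*} [Fintype V] (G : SimpleGraph V) (u v : V) :
    ∑ w, adjMat G u w * adjMat G v w = ((G.neighborSet u ∩ G.neighborSet v).ncard : ℝ) := by
  classical
  have h : ∀ w, adjMat G u w * adjMat G v w = if G.Adj u w ∧ G.Adj v w then 1 else 0 := fun w => by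
    by_cases hu : G.Adj u w <;> by_cases hv : G.Adj v w <;> simp [adjMat, hu, hv]
  rw [Finset.sum_congr rfl fun w _ => h w, Finset.sum_boole, Set.ncard_eq_toFinset_card']
  congr 2
  ext w
  simp

theorem posSemidef_specRad_sub_adjMat {V : Type*} [Fintype V] [DecidableEq V]
    (G : SimpleGraph V) : (specRad G • (1 : Matrix V V ℝ) - adjMat G).PosSemidef := by
  have hA := adjMat_isHermitian G
  have h : specRad G • (1 : Matrix V V ℝ) - adjMat G =
      Unitary.conjStarAlgAut ℝ _ hA.eigenvectorUnitary
        (Matrix.diagonal fun i => specRad G - hA.eigenvalues i) := by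
    have hd : (Matrix.diagonal fun i => specRad G - hA.eigenvalues i) =
        specRad G • (1 : Matrix V V ℝ) - Matrix.diagonal (RCLike.ofReal ∘ hA.eigenvalues) := by
      ext i j
      by_cases hij : i = j <;> simp [hij, Matrix.diagonal]
    rw [hd, map_sub, map_smul, map_one, ← hA.spectral_theorem]
  rw [h, Unitary.conjStarAlgAut_apply]
  refine (Matrix.PosSemidef.diagonal fun i => ?_).mul_mul_conjTranspose_same _
  exact sub_nonneg.2 (le_ciSup (Set.finite_range _).bddAbove i)

/-- A connected graph has a positive eigenvector for its spectral radius. -/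
theorem exists_perron_vector {V : Type*} [Fintype V] [DecidableEq V]
    (G : SimpleGraph V) (hconn : G.Connected) :
    ∃ x : V → ℝ, (∀ v, 0 < x v) ∧ ∀ u, ∑ v, adjMat G u v * x v = specRad G * x u := by
  have := hconn.nonempty
  have hA := adjMat_isHermitian G
  obtain ⟨i, hi⟩ := exists_eq_ciSup_of_finite (f := hA.eigenvalues)
  set y : V → ℝ := ⇑(hA.eigenvectorBasis i) with hy
  have hAy : ∀ u, ∑ v, adjMat G u v * y v = specRad G * y u := fun u => by
    have h := congrFun (hA.mulVec_eigenvectorBasis i) u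
    rw [hi] at h
    exact h
  have hy0 : ∃ v, y v ≠ 0 := by
    by_contra! h
    exact hA.eigenvectorBasis.orthonormal.ne_zero i (PiLp.ext h)
  have hpsd := posSemidef_specRad_sub_adjMat G
  have hmul : ∀ (z : V → ℝ) (u : V), ((specRad G • (1 : Matrix V V ℝ) - adjMat G).mulVec z) u =
      specRad G * z u - ∑ v, adjMat G u v * z v := fun z u => by
    rw [Matrix.sub_mulVec, Matrix.smul_mulVec, Matrix.one_mulVec]
    rfl
  have hz : ∀ u, ∑ v, adjMat G u v * |y v| = specRad G * |y u| := by
    set z : V → ℝ := fun v => |y v| with hz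
    have h0 : star z ⬝ᵥ (specRad G • (1 : Matrix V V ℝ) - adjMat G).mulVec z = 0 := by
      refine le_antisymm ?_ (hpsd.dotProduct_mulVec_nonneg z)
      refine Finset.sum_nonpos fun u _ => ?_
      rw [hmul, star_trivial]
      refine mul_nonpos_of_nonneg_of_nonpos (abs_nonneg _) (sub_nonpos.2 ?_)
      calc specRad G * |y u| ≤ |specRad G * y u| := by
            rw [abs_mul]
            exact mul_le_mul_of_nonneg_right (le_abs_self _) (abs_nonneg _)
        _ ≤ ∑ v, |adjMat G u v * y v| := by
            rw [← hAy]
            exact Finset.abs_sum_le_sum_abs _ _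
        _ = _ := Finset.sum_congr rfl fun v _ => by
            rw [abs_mul, abs_of_nonneg (adjMat_nonneg G u v)]
    intro u
    have h := congrFun ((hpsd.dotProduct_mulVec_zero_iff z).1 h0) u
    rw [hmul] at h
    exact (sub_eq_zero.1 h).symm
  refine ⟨fun v => |y v|, fun v => abs_pos.2 fun hv => ?_, hz⟩
  have hstep : ∀ u v, G.Adj u v → y u = 0 → y v = 0 := by
    intro u v huv hu
    have h := hz u
    rw [hu, abs_zero, mul_zero, Finset.sum_eq_zero_iff_of_nonneg fun w _ =>
      mul_nonneg (adjMat_nonneg G u w) (abs_nonneg _)] at h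
    have h' := h v (Finset.mem_univ v)
    rwa [(adjMat_eq_one_iff G u v).2 huv, one_mul, abs_eq_zero] at h'
  have hwalk : ∀ u v, G.Walk u v → y u = 0 → y v = 0 := by
    intro u v p
    induction p with
    | nil => exact id
    | cons h _ ih => exact fun hu => ih (hstep _ _ h hu)
  obtain ⟨w, hw⟩ := hy0
  obtain ⟨p⟩ := hconn.preconnected v w
  exact hw (hwalk v w p hv)

theorem IsCompleteBipartite.specRad_eq {V : Type*} [Fintype V] [DecidableEq V]
    {G : SimpleGraph V} (hconn : G.Connected) (h : IsCompleteBipartite G) :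
    specRad G = Real.sqrt G.edgeSet.ncard := by
  classical
  have := hconn.nonempty
  obtain ⟨S, hS⟩ := h
  obtain ⟨x, hx, heig⟩ := exists_perron_vector G hconn
  set T : Finset V := Finset.univ.filter (· ∈ S) with hT
  have hmem : ∀ v, v ∈ T ↔ v ∈ S := fun v => by simp [hT]
  have hrow : ∀ (f : V → ℝ) (u : V), ∑ v, adjMat G u v * f v =
      if u ∈ T then ∑ v ∈ Tᶜ, f v else ∑ v ∈ T, f v := by
    intro f u
    have ht : ∀ v, adjMat G u v = if u ∈ T then (if v ∈ Tᶜ then 1 else 0)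
        else (if v ∈ T then 1 else 0) := fun v => by
      by_cases hu : u ∈ S <;> by_cases hv : v ∈ S <;> simp [adjMat, hmem, hS, hu, hv]
    simp only [ht]
    split_ifs <;> simp only [ite_mul, one_mul, zero_mul, Finset.sum_ite_mem, Finset.univ_inter]
  have hsum : ∀ f : V → ℝ, ∑ v, f v = ∑ v ∈ T, f v + ∑ v ∈ Tᶜ, f v := fun f =>
    (Finset.sum_add_sum_compl T f).symm
  set p := ∑ v ∈ T, x v with hp
  set q := ∑ v ∈ Tᶜ, x v with hq
  have hpq : specRad G * p = T.card * q := by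
    rw [hp, Finset.mul_sum, ← nsmul_eq_mul]
    refine Finset.sum_eq_card_nsmul fun u hu => ?_
    rw [← heig, hrow, if_pos hu]
  have hqp : specRad G * q = Tᶜ.card * p := by
    rw [hq, Finset.mul_sum, ← nsmul_eq_mul]
    refine Finset.sum_eq_card_nsmul fun u hu => ?_
    rw [← heig, hrow, if_neg (Finset.mem_compl.1 hu)]
  have hm : (G.edgeSet.ncard : ℝ) = T.card * Tᶜ.card := by
    have h1 := sum_adjMat G
    have h2 : ∀ u, ∑ v, adjMat G u v = if u ∈ T then (Tᶜ.card : ℝ) else T.card := fun u => by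
      simpa using hrow 1 u
    have h3 : ∑ u ∈ T, (if u ∈ T then (Tᶜ.card : ℝ) else T.card) = T.card * Tᶜ.card := by
      rw [Finset.sum_congr rfl fun u hu => if_pos hu, Finset.sum_const, nsmul_eq_mul]
    have h4 : ∑ u ∈ Tᶜ, (if u ∈ T then (Tᶜ.card : ℝ) else T.card) = T.card * Tᶜ.card := by
      rw [Finset.sum_congr rfl fun u hu => if_neg (Finset.mem_compl.1 hu), Finset.sum_const,
        nsmul_eq_mul, mul_comm]
    rw [Finset.sum_congr rfl fun u _ => h2 u, hsum, h3, h4] at h1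
    linarith
  obtain ⟨v⟩ := this
  have hρ : 0 ≤ specRad G := by
    have h : 0 ≤ specRad G * x v := by
      rw [← heig]
      exact Finset.sum_nonneg fun w _ => mul_nonneg (adjMat_nonneg G v w) (hx w).le
    exact nonneg_of_mul_nonneg_left h (hx v)
  have hpos : 0 < p + q := by
    rw [← hsum]
    exact Finset.sum_pos (fun w _ => hx w) ⟨v, Finset.mem_univ v⟩
  have hsq : specRad G ^ 2 = G.edgeSet.ncard := by
    rw [hm]
    refine mul_right_cancel₀ hpos.ne' ?_
    linear_combination specRad G * hpq + T.card * hqp + specRad G * hqp + Tᶜ.card * hpq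
  rw [← hsq, Real.sqrt_sq hρ]

/-- Stability of the two-walk count at a vertex `u₀` of maximal Perron weight. Here `N` and `W` are
the neighbors and the non-neighbors of `u₀` in the graph with 0-1 adjacency function `a`, `x` is the
Perron vector and `ρ` the spectral radius. -/
theorem bipartite_of_sum_le_two_mul_sq {V : Type*} [Fintype V]
    (a : V → V → ℝ) (ha : ∀ u v, a u v = 0 ∨ a u v = 1) (hs : ∀ u v, a u v = a v u)
    (N W : Finset V) (u₀ : V)
    (hsplit : ∀ f : V → ℝ, ∑ v, f v = f u₀ + ∑ v ∈ N, f v + ∑ v ∈ W, f v)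
    (h00 : a u₀ u₀ = 0) (h0N : ∀ v ∈ N, a u₀ v = 1) (h0W : ∀ w ∈ W, a u₀ w = 0)
    (x : V → ℝ) (hx : ∀ v, 0 < x v) (hx1 : ∀ v, x v ≤ 1) (hxu : x u₀ = 1)
    (ρ r : ℝ) (hr : 0 < r) (hρ : 9 * r ≤ ρ)
    (heig : ∀ u, ∑ v, a u v * x v = ρ * x u)
    (hm : ∑ u, ∑ v, a u v ≤ 2 * ρ ^ 2)
    (hfree : ∀ u v, a u v = 1 → ∑ w, a u w * a v w ≤ r) :
    (∀ u ∈ N, ∀ v ∈ N, a u v = 0) ∧ (∀ u ∈ W, ∀ v ∈ W, a u v = 0) ∧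
      ∀ w ∈ W, (∑ v ∈ N, a w v) * (1 - x w) = 0 := by
  have hρ0 : 0 < ρ := by linarith
  have ha0 : ∀ u v, 0 ≤ a u v := fun u v => by rcases ha u v with h | h <;> simp [h]
  have ha1 : ∀ u v, a u v ≤ 1 := fun u v => by rcases ha u v with h | h <;> simp [h]
  have hxN : ∑ v ∈ N, x v = ρ := by
    have h := heig u₀
    rw [hsplit, h00, hxu, Finset.sum_congr rfl (fun v hv => by rw [h0N v hv, one_mul]),
      Finset.sum_eq_zero (s := W) (fun v hv => by rw [h0W v hv, zero_mul])] at h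
    linarith
  set κ : V → ℝ := fun w => ∑ v ∈ N, a w v * x v with hκ
  set M : V → ℝ := fun u => ∑ w ∈ W, (1 - a u w) * κ w with hM
  set c : V → ℝ := fun w => ∑ v ∈ N, a w v with hc
  set EW := ∑ u ∈ W, ∑ v ∈ W, a u v with hEW
  set Γ := ∑ u ∈ N, ∑ v ∈ N, a u v * (x u + x v - 1) with hΓ
  have hκ0 : ∀ w, 0 ≤ κ w := fun w =>
    Finset.sum_nonneg fun v _ => mul_nonneg (ha0 _ _) (hx v).le
  have hκc : ∀ w, κ w ≤ c w := fun w =>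
    Finset.sum_le_sum fun v _ => mul_le_of_le_one_right (ha0 _ _) (hx1 v)
  have hM0 : ∀ u, 0 ≤ M u := fun u =>
    Finset.sum_nonneg fun w _ => mul_nonneg (by linarith [ha1 u w]) (hκ0 w)
  have hEW0 : 0 ≤ EW := Finset.sum_nonneg fun u _ => Finset.sum_nonneg fun v _ => ha0 u v
  have hκW : ∀ w ∈ W, κ w = ρ * x w - ∑ v ∈ W, a w v * x v := by
    intro w hw
    have h := heig w
    rw [hsplit, hs w u₀, h0W w hw] at h
    simp only [hκ]
    linarith
  have hdeg : ∀ u ∈ N, ∑ v ∈ N, a u v ≤ r := by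
    intro u hu
    have h := hfree u₀ u (h0N u hu)
    rw [hsplit, h00, Finset.sum_congr rfl (fun v hv => by rw [h0N v hv, one_mul]),
      Finset.sum_eq_zero (s := W) (fun v hv => by rw [h0W v hv, zero_mul])] at h
    linarith
  have hflip : ∀ (S : Finset V) (f : V → ℝ), ∑ u ∈ S, ∑ v ∈ S, a u v * f v =
      ∑ u ∈ S, (∑ v ∈ S, a u v) * f u := by
    intro S f
    rw [Finset.sum_comm]
    refine Finset.sum_congr rfl fun u _ => ?_
    rw [Finset.sum_mul]
    exact Finset.sum_congr rfl fun v _ => by rw [hs]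
  have hflip' : ∀ (S : Finset V) (f : V → ℝ), ∑ u ∈ S, ∑ v ∈ S, a u v * f u =
      ∑ u ∈ S, (∑ v ∈ S, a u v) * f u := by
    intro S f
    exact Finset.sum_congr rfl fun u _ => by rw [Finset.sum_mul]
  set P := ∑ u ∈ N, (∑ v ∈ N, a u v) * x u with hP
  have hΓP : Γ = 2 * P - ∑ u ∈ N, ∑ v ∈ N, a u v := by
    have : Γ = ∑ u ∈ N, ∑ v ∈ N, a u v * x u + ∑ u ∈ N, ∑ v ∈ N, a u v * x v
        - ∑ u ∈ N, ∑ v ∈ N, a u v := by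
      simp only [hΓ, ← Finset.sum_add_distrib, ← Finset.sum_sub_distrib]
      exact Finset.sum_congr rfl fun u _ => Finset.sum_congr rfl fun v _ => by ring
    rw [this, hflip, hflip']
    ring
  have hP1 : P ≤ r * ρ := by
    rw [← hxN, Finset.mul_sum]
    exact Finset.sum_le_sum fun u hu => mul_le_mul_of_nonneg_right (hdeg u hu) (hx u).le
  have hPE : P ≤ ∑ u ∈ N, ∑ v ∈ N, a u v :=
    Finset.sum_le_sum fun u _ =>
      mul_le_of_le_one_right (Finset.sum_nonneg fun v _ => ha0 u v) (hx1 u)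
  -- the two-walk count at `u₀`
  have hNW : ∀ f : V → ℝ, ∑ v ∈ N, ∑ w ∈ W, a v w * f w = ∑ w ∈ W, c w * f w := by
    intro f
    rw [Finset.sum_comm]
    refine Finset.sum_congr rfl fun w _ => ?_
    rw [hc, Finset.sum_mul]
    exact Finset.sum_congr rfl fun v _ => by rw [hs]
  have hD : ∑ v ∈ N, a v u₀ = ∑ v ∈ N, a u₀ v := Finset.sum_congr rfl fun v _ => hs _ _
  have hwalk : ρ ^ 2 = ∑ v ∈ N, a u₀ v + P + ∑ w ∈ W, c w * x w := by
    calc ρ ^ 2 = ∑ v ∈ N, ρ * x v := by rw [← Finset.mul_sum, hxN, sq]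
      _ = ∑ v ∈ N, (a v u₀ + ∑ y ∈ N, a v y * x y + ∑ w ∈ W, a v w * x w) :=
        Finset.sum_congr rfl fun v _ => by rw [← heig v, hsplit, hxu, mul_one]
      _ = _ := by rw [Finset.sum_add_distrib, Finset.sum_add_distrib, hflip, hNW, hD]
  have hedges : ∑ u, ∑ v, a u v = 2 * ∑ v ∈ N, a u₀ v + ∑ u ∈ N, ∑ v ∈ N, a u v
      + 2 * ∑ w ∈ W, c w + EW := by
    have h1 : ∑ u ∈ N, ∑ v, a u v =
        ∑ v ∈ N, a u₀ v + ∑ u ∈ N, ∑ v ∈ N, a u v + ∑ w ∈ W, c w := by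
      simp only [hsplit, Finset.sum_add_distrib, hD]
      have := hNW 1
      simp only [Pi.one_apply, mul_one] at this
      rw [this]
    have h2 : ∑ u ∈ W, ∑ v, a u v = ∑ w ∈ W, c w + EW := by
      have : ∑ w ∈ W, a w u₀ = 0 := Finset.sum_eq_zero fun w hw => by rw [hs, h0W w hw]
      simp only [hsplit, Finset.sum_add_distrib, this, hEW, hc]
      ring
    rw [hsplit, h1, h2, hsplit (a u₀), h00, Finset.sum_eq_zero (s := W) h0W]
    ring
  have hdef : EW + 2 * ∑ w ∈ W, c w * (1 - x w) ≤ Γ := by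
    have : ∑ w ∈ W, c w * (1 - x w) = ∑ w ∈ W, c w - ∑ w ∈ W, c w * x w := by
      rw [← Finset.sum_sub_distrib]
      exact Finset.sum_congr rfl fun w _ => by ring
    linarith
  have hc1 : ∀ w, 0 ≤ c w * (1 - x w) := fun w =>
    mul_nonneg ((hκ0 w).trans (hκc w)) (by linarith [hx1 w])
  have hc1s : 0 ≤ ∑ w ∈ W, c w * (1 - x w) := Finset.sum_nonneg fun w _ => hc1 w
  have hEWr : EW ≤ r * ρ := by linarith
  -- an edge inside `N` forces many missing edges at its lighter endpoint
  have hmiss : ∀ u ∈ N, ∀ v ∈ N, a u v = 1 → 1 ≤ x u + x v → x u ≤ x v →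
      r * (ρ + r) < M u := by
    intro u hu v hv huv h1 h2
    have hcom := hfree u v huv
    rw [hsplit, hs u u₀, hs v u₀, h0N u hu, h0N v hv] at hcom
    have hcomN : 0 ≤ ∑ w ∈ N, a u w * a v w :=
      Finset.sum_nonneg fun w _ => mul_nonneg (ha0 _ _) (ha0 _ _)
    have hcomx : ∑ w ∈ W, a u w * a v w * x w ≤ ∑ w ∈ W, a u w * a v w :=
      Finset.sum_le_sum fun w _ =>
        mul_le_of_le_one_right (mul_nonneg (ha0 _ _) (ha0 _ _)) (hx1 w)
    have hv' := heig v
    rw [hsplit, hs v u₀, h0N v hv, hxu] at hv'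
    have hκv : κ v ≤ r := (hκc v).trans (hdeg v hv)
    have hkey : ρ * ∑ w ∈ W, a v w * x w - ρ * ∑ w ∈ W, a u w * a v w * x w - EW ≤ M u := by
      rw [Finset.mul_sum, Finset.mul_sum, hEW, ← Finset.sum_sub_distrib,
        ← Finset.sum_sub_distrib]
      refine Finset.sum_le_sum fun w hw => ?_
      have hb : ∑ v ∈ W, a w v * x v ≤ ∑ v ∈ W, a w v :=
        Finset.sum_le_sum fun v _ => mul_le_of_le_one_right (ha0 _ _) (hx1 v)
      have hb0 : 0 ≤ ∑ v ∈ W, a w v := Finset.sum_nonneg fun v _ => ha0 w v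
      have hk := hκW w hw
      have hk0 := hκ0 w
      rcases ha u w with h | h <;> rcases ha v w with h' | h' <;> rw [h, h'] <;> linarith
    have hhalf : 1 / 2 ≤ x v := by linarith
    simp only [hκ] at hκv
    have hA : ρ * x v - 2 * r ≤ ∑ w ∈ W, a v w * x w - ∑ w ∈ W, a u w * a v w * x w := by
      linarith
    nlinarith [mul_le_mul_of_nonneg_left hA hρ0.le, mul_le_mul_of_nonneg_left hhalf (sq_nonneg ρ)]
  have hedge : ∀ u ∈ N, ∀ v ∈ N, a u v = 1 →
      r * (ρ + r) * (x u + x v - 1) < x u * M u + x v * M v := by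
    intro u hu v hv huv
    have hpos : 0 < r * (ρ + r) := by positivity
    have hu0 := mul_nonneg (hx u).le (hM0 u)
    have hv0 := mul_nonneg (hx v).le (hM0 v)
    rcases lt_or_ge (x u + x v) 1 with h | h
    · nlinarith
    rcases le_total (x u) (x v) with h' | h'
    · have := hmiss u hu v hv huv h h'
      nlinarith [mul_lt_mul_of_pos_left this (hx u),
        mul_le_mul_of_nonneg_left (show x u + x v - 1 ≤ x u by linarith [hx1 v]) hpos.le]
    · have := hmiss v hv u hu (hs u v ▸ huv) (by linarith) h'
      nlinarith [mul_lt_mul_of_pos_left this (hx v),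
        mul_le_mul_of_nonneg_left (show x u + x v - 1 ≤ x v by linarith [hx1 u]) hpos.le]
  have hdeficit : 2 * ∑ u ∈ N, x u * M u ≤ (ρ + r) * Γ := by
    have h1 : ρ * ∑ w ∈ W, κ w * (1 - x w) =
        ∑ u ∈ N, x u * M u - ∑ w ∈ W, ∑ w' ∈ W, a w w' * (κ w * x w') := by
      have : ∑ u ∈ N, x u * M u = ∑ w ∈ W, κ w * (ρ - κ w) := by
        simp only [hM, Finset.mul_sum]
        rw [Finset.sum_comm]
        refine Finset.sum_congr rfl fun w _ => ?_
        rw [← hxN, ← Finset.sum_sub_distrib, Finset.mul_sum]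
        exact Finset.sum_congr rfl fun v _ => by rw [hs v w]; ring
      rw [this, Finset.mul_sum, ← Finset.sum_sub_distrib]
      refine Finset.sum_congr rfl fun w hw => ?_
      have : ∑ w' ∈ W, a w w' * (κ w * x w') = κ w * ∑ w' ∈ W, a w w' * x w' := by
        rw [Finset.mul_sum]
        exact Finset.sum_congr rfl fun v _ => by ring
      rw [this]
      linear_combination κ w * hκW w hw
    have h2 : 2 * ∑ w ∈ W, ∑ w' ∈ W, a w w' * (κ w * x w') ≤ (ρ + r) * EW := by
      have h3 : ∑ w ∈ W, ∑ w' ∈ W, a w w' * (κ w * x w') ≤ ∑ w ∈ W, ∑ w' ∈ W, a w w' * κ w :=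
        Finset.sum_le_sum fun w _ => Finset.sum_le_sum fun w' _ =>
          mul_le_mul_of_nonneg_left (mul_le_of_le_one_right (hκ0 w) (hx1 w')) (ha0 _ _)
      have h4 : ∑ w ∈ W, ∑ w' ∈ W, a w w' * κ w = ∑ w ∈ W, ∑ w' ∈ W, a w w' * κ w' := by
        rw [hflip, hflip']
      have h5 : ∑ w ∈ W, ∑ w' ∈ W, a w w' * κ w + ∑ w ∈ W, ∑ w' ∈ W, a w w' * κ w' ≤
          (ρ + r) * EW := by
        simp only [hEW, Finset.mul_sum, ← Finset.sum_add_distrib]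
        refine Finset.sum_le_sum fun w hw => Finset.sum_le_sum fun w' hw' => ?_
        rcases ha w w' with h | h
        · rw [h]; simp
        rw [h]
        have hcom := hfree w w' h
        rw [hsplit, hs w u₀, h0W w hw] at hcom
        have h6 : 0 ≤ ∑ v ∈ W, a w v * a w' v :=
          Finset.sum_nonneg fun v _ => mul_nonneg (ha0 _ _) (ha0 _ _)
        have h7 : κ w + κ w' ≤ ρ + ∑ v ∈ N, a w v * a w' v := by
          rw [← hxN]
          simp only [hκ, ← Finset.sum_add_distrib]
          refine Finset.sum_le_sum fun v _ => ?_
          have := hx1 v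
          have := hx v
          rcases ha w v with h | h <;> rcases ha w' v with h' | h' <;> rw [h, h'] <;> linarith
        linarith
      linarith
    have h8 : ∑ w ∈ W, κ w * (1 - x w) ≤ ∑ w ∈ W, c w * (1 - x w) :=
      Finset.sum_le_sum fun w _ => mul_le_mul_of_nonneg_right (hκc w) (by linarith [hx1 w])
    nlinarith [mul_le_mul_of_nonneg_left h8 hρ0.le,
      mul_le_mul_of_nonneg_left hdef (show 0 ≤ ρ + r by linarith), mul_nonneg hr.le hc1s]
  have hN : ∀ u ∈ N, ∀ v ∈ N, a u v = 0 := by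
    by_contra! hcon
    obtain ⟨u, hu, v, hv, huv⟩ := hcon
    have h1 : ∀ u ∈ N, ∀ v ∈ N, a u v * (r * (ρ + r) * (x u + x v - 1)) ≤
        a u v * (x u * M u + x v * M v) := by
      intro u hu v hv
      rcases ha u v with h | h
      · rw [h]; simp
      · rw [h, one_mul, one_mul]; exact (hedge u hu v hv h).le
    have h2 : ∑ u ∈ N, ∑ v ∈ N, a u v * (r * (ρ + r) * (x u + x v - 1)) <
        ∑ u ∈ N, ∑ v ∈ N, a u v * (x u * M u + x v * M v) := by
      refine Finset.sum_lt_sum (fun u hu => Finset.sum_le_sum (h1 u hu)) ⟨u, hu, ?_⟩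
      refine Finset.sum_lt_sum (h1 u hu) ⟨v, hv, ?_⟩
      have h := (ha u v).resolve_left huv
      rw [h, one_mul, one_mul]
      exact hedge u hu v hv h
    have h3 : ∑ u ∈ N, ∑ v ∈ N, a u v * (r * (ρ + r) * (x u + x v - 1)) =
        r * (ρ + r) * Γ := by
      simp only [hΓ, Finset.mul_sum]
      exact Finset.sum_congr rfl fun u _ => Finset.sum_congr rfl fun v _ => by ring
    have h4 : ∑ u ∈ N, ∑ v ∈ N, a u v * (x u * M u + x v * M v) =
        2 * ∑ u ∈ N, (∑ v ∈ N, a u v) * (x u * M u) := by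
      simp only [mul_add, Finset.sum_add_distrib]
      rw [hflip N (fun u => x u * M u), hflip' N (fun u => x u * M u)]
      ring
    have h5 : ∑ u ∈ N, (∑ v ∈ N, a u v) * (x u * M u) ≤ r * ∑ u ∈ N, x u * M u := by
      rw [Finset.mul_sum]
      exact Finset.sum_le_sum fun u hu =>
        mul_le_mul_of_nonneg_right (hdeg u hu) (mul_nonneg (hx u).le (hM0 u))
    nlinarith [mul_le_mul_of_nonneg_left hdeficit hr.le]
  have hΓ0 : Γ = 0 := Finset.sum_eq_zero fun u hu => Finset.sum_eq_zero fun v hv => by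
    rw [hN u hu v hv, zero_mul]
  refine ⟨hN, fun u hu v hv => ?_, fun w hw => ?_⟩
  · have h : EW = 0 := by linarith
    rw [hEW, Finset.sum_eq_zero_iff_of_nonneg fun u _ => Finset.sum_nonneg fun v _ => ha0 u v] at h
    exact (Finset.sum_eq_zero_iff_of_nonneg fun v _ => ha0 u v).1 (h u hu) v hv
  · have h : ∑ w ∈ W, c w * (1 - x w) = 0 := by linarith
    exact (Finset.sum_eq_zero_iff_of_nonneg fun w _ => hc1 w).1 h w hw

theorem isCompleteBipartite_of_sqrt_le_specRad {V : Type*} [Fintype V] [DecidableEq V]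
    (G : SimpleGraph V) (hconn : G.Connected) (r : ℕ) (hr : 1 ≤ r)
    (hm : (9 * r) ^ 2 ≤ G.edgeSet.ncard)
    (hfree : ∀ u v, G.Adj u v → (G.neighborSet u ∩ G.neighborSet v).ncard ≤ r)
    (hρ : Real.sqrt G.edgeSet.ncard ≤ specRad G) : IsCompleteBipartite G := by
  classical
  have := hconn.nonempty
  obtain ⟨y, hy, hyeig⟩ := exists_perron_vector G hconn
  obtain ⟨u₀, hu₀⟩ := Finite.exists_max y
  set x : V → ℝ := fun v => y v / y u₀ with hxdef
  have hx : ∀ v, 0 < x v := fun v => div_pos (hy v) (hy u₀)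
  have hx1 : ∀ v, x v ≤ 1 := fun v => div_le_one_of_le₀ (hu₀ v) (hy u₀).le
  have hxu : x u₀ = 1 := div_self (hy u₀).ne'
  have heig : ∀ u, ∑ v, adjMat G u v * x v = specRad G * x u := fun u => by
    simp only [hxdef, ← mul_div_assoc]
    rw [← Finset.sum_div, hyeig]
  set N : Finset V := Finset.univ.filter (G.Adj u₀) with hN
  set W : Finset V := Finset.univ.filter fun v => v ≠ u₀ ∧ ¬ G.Adj u₀ v with hW
  have hmemN : ∀ v, v ∈ N ↔ G.Adj u₀ v := fun v => by simp [hN]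
  have hmemW : ∀ v, v ∈ W ↔ v ≠ u₀ ∧ ¬ G.Adj u₀ v := fun v => by simp [hW]
  have hsplit : ∀ f : V → ℝ, ∑ v, f v = f u₀ + ∑ v ∈ N, f v + ∑ v ∈ W, f v := by
    intro f
    have h1 : insert u₀ W = Finset.univ.filter fun v => ¬ G.Adj u₀ v := by
      ext v
      by_cases hv : v = u₀ <;> simp [hmemW, hv]
    have h2 : u₀ ∉ W := by simp [hmemW]
    rw [← Finset.sum_filter_add_sum_filter_not Finset.univ (G.Adj u₀) f, ← h1,
      Finset.sum_insert h2]
    ring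
  have h9 : (9 * r : ℝ) ≤ specRad G := by
    refine le_trans (Real.le_sqrt_of_sq_le ?_) hρ
    exact_mod_cast hm
  have hsum : ∑ u, ∑ v, adjMat G u v ≤ 2 * specRad G ^ 2 := by
    rw [sum_adjMat]
    linarith [(Real.sqrt_le_left ((Real.sqrt_nonneg _).trans hρ)).1 hρ]
  obtain ⟨hNN, hWW, hNW⟩ := bipartite_of_sum_le_two_mul_sq (adjMat G) (adjMat_eq_zero_or_one G)
    (adjMat_comm G) N W u₀ hsplit ((adjMat_eq_zero_iff G _ _).2 (G.loopless.irrefl u₀))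
    (fun v hv => (adjMat_eq_one_iff G _ _).2 ((hmemN v).1 hv))
    (fun v hv => (adjMat_eq_zero_iff G _ _).2 ((hmemW v).1 hv).2)
    x hx hx1 hxu (specRad G) r (by exact_mod_cast hr) h9 heig hsum
    (fun u v huv => by
      rw [sum_adjMat_mul_adjMat]
      exact_mod_cast hfree u v ((adjMat_eq_one_iff G _ _).1 huv))
  have hcomplete : ∀ w ∈ W, ∀ v ∈ N, G.Adj w v := by
    intro w hw v hv
    have h0 : adjMat G w u₀ = 0 := by
      rw [adjMat_comm, adjMat_eq_zero_iff]
      exact ((hmemW w).1 hw).2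
    have hrow := heig w
    rw [hsplit, h0, Finset.sum_eq_zero (s := W) fun w' hw' => by rw [hWW w hw w' hw', zero_mul],
      zero_mul, zero_add, add_zero] at hrow
    have hne : ∑ v ∈ N, adjMat G w v ≠ 0 := by
      intro h
      rw [Finset.sum_eq_zero_iff_of_nonneg fun v _ => adjMat_nonneg G w v] at h
      rw [Finset.sum_eq_zero fun v hv => by rw [h v hv, zero_mul]] at hrow
      have : 0 < specRad G * x w :=
        mul_pos (lt_of_lt_of_le (mul_pos (by norm_num) (by exact_mod_cast hr)) h9) (hx w)
      linarith
    have hw1 : x w = 1 := by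
      linarith [(mul_eq_zero.1 (hNW w hw)).resolve_left hne]
    have hrow₀ := heig u₀
    rw [hsplit, (adjMat_eq_zero_iff G u₀ u₀).2 (G.loopless.irrefl u₀),
      Finset.sum_eq_zero (s := W) fun w' hw' => by
        rw [(adjMat_eq_zero_iff G _ _).2 ((hmemW w').1 hw').2, zero_mul],
      zero_mul, zero_add, add_zero, hxu, ← hw1, ← hrow] at hrow₀
    by_contra hwv
    refine hrow₀.not_gt (Finset.sum_lt_sum (fun v' hv' => ?_) ⟨v, hv, ?_⟩)
    · rw [(adjMat_eq_one_iff G _ _).2 ((hmemN v').1 hv')]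
      refine mul_le_mul_of_nonneg_right ?_ (hx v').le
      rcases adjMat_eq_zero_or_one G w v' with h | h <;> simp [h]
    · rw [(adjMat_eq_one_iff G _ _).2 ((hmemN v).1 hv), (adjMat_eq_zero_iff G _ _).2 hwv]
      simpa using hx v
  have hin : ∀ u ∈ N, ∀ v, v ∉ N → G.Adj u v := by
    intro u hu v hv
    rcases eq_or_ne v u₀ with rfl | hvu
    · exact ((hmemN u).1 hu).symm
    · exact (hcomplete v ((hmemW v).2 ⟨hvu, fun h => hv ((hmemN v).2 h)⟩) u hu).symm
  refine ⟨N, fun u v => ?_⟩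
  simp only [Finset.mem_coe]
  constructor
  · intro huv
    by_cases hu : u ∈ N <;> by_cases hv : v ∈ N
    · exact absurd huv ((adjMat_eq_zero_iff G _ _).1 (hNN u hu v hv))
    · exact Or.inl ⟨hu, hv⟩
    · exact Or.inr ⟨hu, hv⟩
    · rw [hmemN] at hu hv
      have hu' : u ≠ u₀ := fun h => hv (h ▸ huv)
      have hv' : v ≠ u₀ := fun h => hu (h ▸ huv.symm)
      exact absurd huv ((adjMat_eq_zero_iff G _ _).1
        (hWW u ((hmemW u).2 ⟨hu', hu⟩) v ((hmemW v).2 ⟨hv', hv⟩)))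
  · rintro (⟨hu, hv⟩ | ⟨hu, hv⟩)
    · exact hin u hu v hv
    · exact (hin v hv u hu).symm

/-- If `G` is a connected `B_{r+1}`-free graph (every two adjacent
vertices have at most `r` common neighbors) with `m ≥ (9r)²` edges, then
`ρ(G) ≤ √m`, with equality iff `G` is complete bipartite. -/
theorem booksize_spectral_bound {V : Type*} [Fintype V] [DecidableEq V]
    (G : SimpleGraph V) (hconn : G.Connected)
    (r m : ℕ) (hr : 1 ≤ r)
    (hm : G.edgeSet.ncard = m) (hm' : (9 * r) ^ 2 ≤ m)
    (hfree : ∀ u v, G.Adj u v → (G.neighborSet u ∩ G.neighborSet v).ncard ≤ r) :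
    specRad G ≤ Real.sqrt m ∧
      (specRad G = Real.sqrt m ↔ IsCompleteBipartite G) := by
  subst hm
  have key := isCompleteBipartite_of_sqrt_le_specRad G hconn r hr hm' hfree
  refine ⟨?_, fun h => key h.ge, fun h => h.specRad_eq hconn⟩
  by_contra! h
  exact h.ne' ((key h.le).specRad_eq hconn)
end

section
/- Let s be a positive integer and m an integer with s dividing m − 1 and m ≥ (240s)². Let ρ₀ = ρ(S⁺_{m,s}) be the spectral radius of S⁺_{m,s}. Then ρ₀² = m − 1 + 2s/(ρ₀ − 1). -/
/-- `SPlus s t` is the graph obtained from the complete bipartite graph `K_{s,t}`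
(on parts `Fin s` and `Fin t`) by adding one edge inside the part of size `t`
(joining the vertices with values `0` and `1`).  For `s ∣ m - 1` and
`t = (m-1)/s ≥ 2` this is the graph `S⁺_{m,s}`, with exactly `m` edges. -/
def SPlus (s t : ℕ) : SimpleGraph (Fin s ⊕ Fin t) :=
  SimpleGraph.fromRel (fun a b =>
    (a.isLeft ∧ b.isRight) ∨
      (∃ i j : Fin t, a = Sum.inr i ∧ b = Sum.inr j ∧ (i : ℕ) = 0 ∧ (j : ℕ) = 1))

open Matrix in
theorem Matrix.IsHermitian.dotProduct_mulVec_le {n : Type*} [Fintype n] [DecidableEq n]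
    {A : Matrix n n ℝ} (hA : A.IsHermitian) {c : ℝ} (hc : ∀ i, hA.eigenvalues i ≤ c)
    (x : n → ℝ) : x ⬝ᵥ A *ᵥ x ≤ c * (x ⬝ᵥ x) := by
  have hpsd : (algebraMap ℝ (Matrix n n ℝ) c - A).PosSemidef := by
    rw [posSemidef_iff_isHermitian_and_spectrum_nonneg]
    refine ⟨?_, ?_⟩
    · refine IsHermitian.sub ?_ hA
      rw [algebraMap_eq_diagonal]
      exact isHermitian_diagonal _
    · rw [← spectrum.singleton_sub_eq, hA.spectrum_real_eq_range_eigenvalues]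
      rintro _ ⟨_, rfl, _, ⟨i, rfl⟩, rfl⟩
      simpa using hc i
  have h := hpsd.dotProduct_mulVec_nonneg x
  rw [Algebra.algebraMap_eq_smul_one, sub_mulVec, smul_mulVec, one_mulVec, star_trivial,
    dotProduct_sub, dotProduct_smul, smul_eq_mul] at h
  linarith

open Matrix in
theorem exists_eigenvector_specRad {V : Type*} [Fintype V] [DecidableEq V] [Nonempty V]
    (G : SimpleGraph V) : ∃ v ≠ 0, adjMat G *ᵥ v = specRad G • v := by
  obtain ⟨i, hi⟩ := exists_eq_ciSup_of_finite (f := (adjMat_isHermitian G).eigenvalues)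
  refine ⟨((adjMat_isHermitian G).eigenvectorBasis i).ofLp, fun h => ?_, ?_⟩
  · exact (adjMat_isHermitian G).eigenvectorBasis.toBasis.ne_zero i
      (by simpa using h)
  · rw [IsHermitian.mulVec_eigenvectorBasis, hi, specRad]

open Matrix in
theorem dotProduct_adjMat_mulVec_le {V : Type*} [Fintype V] [DecidableEq V]
    (G : SimpleGraph V) (x : V → ℝ) : x ⬝ᵥ adjMat G *ᵥ x ≤ specRad G * (x ⬝ᵥ x) :=
  (adjMat_isHermitian G).dotProduct_mulVec_le
    (fun i => le_ciSup (Set.finite_range _).bddAbove i) x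

open Matrix in
theorem adjMat_SPlus_mulVec_inl {s n : ℕ} (v : Fin s ⊕ Fin (n + 2) → ℝ) (i : Fin s) :
    (adjMat (SPlus s (n + 2)) *ᵥ v) (Sum.inl i) = ∑ j, v (Sum.inr j) := by
  simp [mulVec, dotProduct, adjMat, SPlus]

open Matrix in
theorem adjMat_SPlus_mulVec_inr {s n : ℕ} (v : Fin s ⊕ Fin (n + 2) → ℝ) (j : Fin (n + 2)) :
    (adjMat (SPlus s (n + 2)) *ᵥ v) (Sum.inr j) = ∑ i, v (Sum.inl i) +
      ((if j = 0 then v (Sum.inr 1) else 0) + if j = 1 then v (Sum.inr 0) else 0) := by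
  have h0 (k : Fin (n + 2)) : (k : ℕ) = 0 ↔ k = 0 := Fin.val_eq_zero_iff
  have h1 (k : Fin (n + 2)) : (k : ℕ) = 1 ↔ k = 1 := by rw [Fin.ext_iff, Fin.val_one]
  have hadj (k : Fin (n + 2)) : (SPlus s (n + 2)).Adj (Sum.inr j) (Sum.inr k) ↔
      (j = 0 ∧ k = 1) ∨ (j = 1 ∧ k = 0) := by
    simp only [SPlus, SimpleGraph.fromRel_adj, Sum.isLeft_inr, Sum.inr.injEq, h0, h1]
    grind
  have hadj' (i : Fin s) : (SPlus s (n + 2)).Adj (Sum.inr j) (Sum.inl i) := by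
    simp [SPlus]
  simp only [mulVec, dotProduct, adjMat, of_apply, Fintype.sum_sum_type, hadj, hadj', if_true,
    one_mul, add_right_inj]
  by_cases hj0 : j = 0
  · simp [hj0]
  · by_cases hj1 : j = 1
    · subst hj1
      simp
    · simp [hj0, hj1]

theorem one_lt_specRad_SPlus {s n : ℕ} (hs : 1 ≤ s) : 1 < specRad (SPlus s (n + 2)) := by
  have h := dotProduct_adjMat_mulVec_le (SPlus s (n + 2)) 1
  simp only [dotProduct, Fintype.sum_sum_type, adjMat_SPlus_mulVec_inl,
    adjMat_SPlus_mulVec_inr, Pi.one_apply, one_mul, Finset.sum_add_distrib,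
    Finset.sum_ite_eq', Finset.sum_const, Finset.card_univ, Fintype.card_sum, Fintype.card_fin, nsmul_eq_mul,
    mul_one, Finset.mem_univ, if_true] at h
  have hs' : (1 : ℝ) ≤ s := by exact_mod_cast hs
  have hn : (0 : ℝ) ≤ n := n.cast_nonneg
  push_cast at h
  by_contra! hle
  nlinarith [mul_nonneg (sub_nonneg.2 hs') hn]

theorem specRad_SPlus_sq {s n : ℕ} (hs : 1 ≤ s) :
    specRad (SPlus s (n + 2)) ^ 2 =
      (s : ℝ) * (n + 2) + 2 * s / (specRad (SPlus s (n + 2)) - 1) := by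
  obtain ⟨v, hv, hev⟩ := exists_eigenvector_specRad (SPlus s (n + 2))
  have hρ := one_lt_specRad_SPlus (n := n) hs
  set ρ := specRad (SPlus s (n + 2))
  set A := ∑ i, v (Sum.inl i) with hA
  set B := ∑ j, v (Sum.inr j) with hB
  have hl (i : Fin s) : B = ρ * v (Sum.inl i) := by
    simpa [adjMat_SPlus_mulVec_inl] using congrFun hev (Sum.inl i)
  have hr (j : Fin (n + 2)) : A + ((if j = 0 then v (Sum.inr 1) else 0) +
      if j = 1 then v (Sum.inr 0) else 0) = ρ * v (Sum.inr j) := by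
    simpa [adjMat_SPlus_mulVec_inr] using congrFun hev (Sum.inr j)
  have h0 : A + v (Sum.inr 1) = ρ * v (Sum.inr 0) := by simpa using hr 0
  have h1 : A + v (Sum.inr 0) = ρ * v (Sum.inr 1) := by simpa using hr 1
  have hsl : s * B = ρ * A := by
    calc
      s * B = ∑ _i : Fin s, B := by simp
      _ = ρ * A := by rw [hA, Finset.mul_sum, Finset.sum_congr rfl fun i _ => hl i]
  have hsr : (n + 2) * A + (v (Sum.inr 1) + v (Sum.inr 0)) = ρ * B := by
    have : ρ * B = ∑ j, ρ * v (Sum.inr j) := Finset.mul_sum ..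
    rw [this, ← Finset.sum_congr rfl fun j _ => hr j]
    simp [Finset.sum_add_distrib]
  have hA0 : A ≠ 0 := by
    intro hA0
    rw [hA0] at h0 h1 hr hsl
    have hb0 : v (Sum.inr 0) = 0 := by
      have : (ρ ^ 2 - 1) * v (Sum.inr 0) = 0 := by linear_combination -ρ * h0 - h1
      exact (mul_eq_zero.1 this).resolve_left (by nlinarith)
    have hb1 : v (Sum.inr 1) = 0 := by simpa [hb0] using h0
    have hB0 : B = 0 := by
      have : (s : ℝ) ≠ 0 := by positivity
      simpa [this] using hsl
    refine hv (funext fun x => ?_)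
    have hρ0 : ρ ≠ 0 := by positivity
    rcases x with i | j
    · simpa [hB0, hρ0] using (hl i).symm
    · simpa [hb0, hb1, hρ0] using (hr j).symm
  have hρ1 : ρ - 1 ≠ 0 := by linarith
  field_simp
  apply mul_right_cancel₀ hA0
  linear_combination -(ρ - 1) * ρ * hsl - s * (ρ - 1) * hsr - s * (h0 + h1)

/-- For `s ≥ 1`, `s ∣ m - 1` and `m ≥ (240s)²`, the spectral radius
`ρ₀` of `S⁺_{m,s}` satisfies `ρ₀² = m - 1 + 2s/(ρ₀ - 1)`. -/
theorem specRad_SPlus_eq (s m : ℕ) (hs : 1 ≤ s) (hdvd : s ∣ (m - 1))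
    (hm : (240 * s) ^ 2 ≤ m) :
    specRad (SPlus s ((m - 1) / s)) ^ 2 =
      (m : ℝ) - 1 + 2 * s / (specRad (SPlus s ((m - 1) / s)) - 1) := by
  have hm' : 2 * s + 1 ≤ m := by nlinarith
  obtain ⟨t, ht⟩ := hdvd
  have hdiv : (m - 1) / s = t := by rw [ht, Nat.mul_div_cancel_left _ hs]
  have ht2 : 2 ≤ t := by
    by_contra! hlt
    have : s * t ≤ s * 1 := Nat.mul_le_mul_left s (by omega)
    omega
  obtain ⟨n, rfl⟩ := Nat.exists_eq_add_of_le' ht2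
  have hcast : (m : ℝ) - 1 = s * (n + 2) := by
    have : m = s * (n + 2) + 1 := by omega
    rw [this]
    push_cast
    ring
  rw [hdiv, hcast]
  exact specRad_SPlus_sq hs
end

section
/- Under the Perron setup, let c ≥ 1 be a real constant and let S ⊆ U be any set of vertices each of which has strictly more than cρ/4.5 neighbors in W \ W*. Then Σ_{w ∈ W\W*} f(w) ≥ Σ_{w ∈ W\W*} d_U(w)(x_{u*} − x_w) ≥ c·r·|S|·x_{u*}; moreover, if S is nonempty, the inequality Σ_{w ∈ W\W*} f(w) ≥ c·r·|S|·x_{u*} is strict. -/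
section PerronSetup

variable {V : Type*} [Fintype V] [DecidableEq V]

/-- The number of neighbors of `w` inside the vertex set `S`. -/
def dIn (G : SimpleGraph V) [DecidableRel G.Adj] (S : Finset V) (w : V) : ℕ :=
  (G.neighborFinset w ∩ S).card

/-- The quantity `f(w) = d_U(w) (x_{u*} - x_w) + (1/2) d_W(w) x_{u*}`. -/
noncomputable def fW (G : SimpleGraph V) [DecidableRel G.Adj] (U W : Finset V)
    (x : V → ℝ) (ustar : V) (w : V) : ℝ :=
  (dIn G U w : ℝ) * (x ustar - x w) + (1 / 2) * (dIn G W w : ℝ) * x ustar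

/-- Double counting of the edges between two vertex sets. -/
theorem sum_dIn_comm (G : SimpleGraph V) [DecidableRel G.Adj] (A B : Finset V) :
    ∑ a ∈ A, dIn G B a = ∑ b ∈ B, dIn G A b := by
  have key (C : Finset V) (v : V) : dIn G C v = ∑ w ∈ C, if G.Adj v w then 1 else 0 := by
    rw [dIn, ← Finset.card_filter]
    congr 1
    ext w
    simp [and_comm]
  simp only [key]
  rw [Finset.sum_comm]
  simp only [G.adj_comm]

theorem dIn_mono (G : SimpleGraph V) [DecidableRel G.Adj] {A B : Finset V} (h : A ⊆ B) (v : V) :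
    dIn G A v ≤ dIn G B v :=
  Finset.card_le_card (Finset.inter_subset_inter_left h)

theorem eigenvalue_pos_of_adj (G : SimpleGraph V) [DecidableRel G.Adj] {ρ : ℝ} {x : V → ℝ}
    (hx : ∀ v, 0 < x v) (heig : (G.adjMatrix ℝ).mulVec x = ρ • x) {u v : V} (huv : G.Adj u v) :
    0 < ρ := by
  have h := congrFun heig u
  rw [SimpleGraph.adjMatrix_mulVec_apply, Pi.smul_apply, smul_eq_mul] at h
  have hsum : 0 < ∑ w ∈ G.neighborFinset u, x w :=
    Finset.sum_pos (fun w _ => hx w) ⟨v, by simpa using huv⟩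
  exact pos_of_mul_pos_left (h ▸ hsum) (hx u).le

/-- **Claim 2.1.** For a constant `c ≥ 1` and any set `S ⊆ U` of vertices each having strictly more than `cρ/4.5` neighbors in `W \\ W*`, we have `Σ_{w ∈ W\\W*} f(w) ≥ Σ_{w ∈ W\\W*} d_U(w)(x_{u*} - x_w) ≥ c r |S| x_{u*}`, with the first bound strict whenever `S` is nonempty. -/
theorem claim_2_1
    {V : Type*} [Fintype V] [DecidableEq V]
    (G : SimpleGraph V) [DecidableRel G.Adj] (hconn : G.Connected)
    (r : ℕ) (hr : 1 ≤ r)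
    (hfree : ∀ u v, G.Adj u v → (G.neighborFinset u ∩ G.neighborFinset v).card ≤ r)
    (hm : 1 ≤ G.edgeFinset.card)
    (ρ : ℝ) (x : V → ℝ) (hx : ∀ v, 0 < x v)
    (heig : (G.adjMatrix ℝ).mulVec x = ρ • x)
    (ustar : V) (hustar : ∀ v, x v ≤ x ustar)
    (U W Wstar : Finset V)
    (hU : U = G.neighborFinset ustar)
    (hW : W = Finset.univ \ insert ustar U)
    (hWstar : Wstar = W.filter (fun w => (1 - 4.5 * r / ρ) * x ustar ≤ x w))
    (c : ℝ) (hc : 1 ≤ c)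
    (S : Finset V) (hS : S ⊆ U)
    (hSdeg : ∀ u ∈ S, c * ρ / 4.5 < (dIn G (W \ Wstar) u : ℝ))
    :
    (∑ w ∈ W \ Wstar, fW G U W x ustar w ≥
        ∑ w ∈ W \ Wstar, (dIn G U w : ℝ) * (x ustar - x w)) ∧
    (∑ w ∈ W \ Wstar, (dIn G U w : ℝ) * (x ustar - x w) ≥ c * r * S.card * x ustar) ∧
    (S.Nonempty →
      c * r * S.card * x ustar < ∑ w ∈ W \ Wstar, fW G U W x ustar w) := by
  have hx0 := hx ustar
  have hfirst : ∑ w ∈ W \ Wstar, (dIn G U w : ℝ) * (x ustar - x w) ≤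
      ∑ w ∈ W \ Wstar, fW G U W x ustar w :=
    Finset.sum_le_sum fun w _ => le_add_of_nonneg_right (by positivity)
  have hstrict (hne : S.Nonempty) : c * r * S.card * x ustar <
      ∑ w ∈ W \ Wstar, (dIn G U w : ℝ) * (x ustar - x w) := by
    obtain ⟨s, hs⟩ := hne
    have hadj : G.Adj ustar s := by simpa [hU] using hS hs
    have hρ : 0 < ρ := eigenvalue_pos_of_adj G hx heig hadj
    have hr0 : (0 : ℝ) < r := by exact_mod_cast hr
    have hedges : S.card * (c * ρ / 4.5) < ∑ w ∈ W \ Wstar, (dIn G U w : ℝ) :=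
      calc S.card * (c * ρ / 4.5) = ∑ _u ∈ S, c * ρ / 4.5 := by simp
        _ < ∑ u ∈ S, (dIn G (W \ Wstar) u : ℝ) := Finset.sum_lt_sum_of_nonempty ⟨s, hs⟩ hSdeg
        _ = ∑ w ∈ W \ Wstar, (dIn G S w : ℝ) := by exact_mod_cast sum_dIn_comm G S (W \ Wstar)
        _ ≤ ∑ w ∈ W \ Wstar, (dIn G U w : ℝ) :=
          Finset.sum_le_sum fun w _ => by exact_mod_cast dIn_mono G hS w
    calc c * r * S.card * x ustar
        = S.card * (c * ρ / 4.5) * (4.5 * r / ρ * x ustar) := by field_simp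
      _ < (∑ w ∈ W \ Wstar, (dIn G U w : ℝ)) * (4.5 * r / ρ * x ustar) :=
          mul_lt_mul_of_pos_right hedges (by positivity)
      _ = ∑ w ∈ W \ Wstar, (dIn G U w : ℝ) * (4.5 * r / ρ * x ustar) := Finset.sum_mul ..
      _ ≤ ∑ w ∈ W \ Wstar, (dIn G U w : ℝ) * (x ustar - x w) := by
          refine Finset.sum_le_sum fun w hw => mul_le_mul_of_nonneg_left ?_ (Nat.cast_nonneg _)
          have hlt : x w < (1 - 4.5 * r / ρ) * x ustar := by
            simp only [hWstar, Finset.mem_sdiff, Finset.mem_filter, not_and, not_le] at hw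
            exact hw.2 hw.1
          linarith
  refine ⟨hfirst, ?_, fun hne => (hstrict hne).trans_le hfirst⟩
  rcases S.eq_empty_or_nonempty with rfl | hne
  · simpa using Finset.sum_nonneg fun w (_ : w ∈ W \ Wstar) =>
      mul_nonneg (Nat.cast_nonneg (dIn G U w)) (sub_nonneg.2 (hustar w))
  · exact (hstrict hne).le

end PerronSetup
end

section
/- Under the Perron setup, let c ≥ 1 be a real constant and let u ∈ U be a vertex such that u has at most cρ/4.5 neighbors in W \ W* and u has at least one neighbor v₀ ∈ U with x_{v₀} ≤ x_u. Set λ = x_u / x_{u*}. Then the number of neighbors of u in W* satisfies d_{W*}(u) ≥ (λ − c/4.5)ρ − (r + λ). -/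
section PerronSetup

variable {V : Type*} [Fintype V] [DecidableEq V]

/-- In an eigenvector equation for the adjacency matrix, every neighbor of `u` contributes at most
the maximal weight `M`, and a chosen neighbor `v` contributes exactly its own weight. -/
lemma eigenvalue_mul_le_of_adj
    {V : Type*} [Fintype V] [DecidableEq V] (G : SimpleGraph V) [DecidableRel G.Adj]
    {ρ M : ℝ} {x : V → ℝ} (heig : (G.adjMatrix ℝ).mulVec x = ρ • x) (hM : ∀ v, x v ≤ M)
    {u v : V} (huv : G.Adj u v) :
    ρ * x u ≤ ((G.neighborFinset u).card - 1 : ℝ) * M + x v := by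
  have hv : v ∈ G.neighborFinset u := by simpa using huv
  have hsum : ∑ w ∈ G.neighborFinset u, x w = ρ * x u := by
    simpa [SimpleGraph.adjMatrix_mulVec_apply] using congrFun heig u
  have hcard : (((G.neighborFinset u).erase v).card : ℝ) = (G.neighborFinset u).card - 1 := by
    rw [← Finset.card_erase_add_one hv]
    push_cast
    ring
  have hle := Finset.sum_le_card_nsmul ((G.neighborFinset u).erase v) x M fun w _ => hM w
  rw [nsmul_eq_mul, hcard] at hle
  rw [← hsum, ← Finset.sum_erase_add _ _ hv]
  linarith

/-- The neighbors of `u` are split among `a`, `S`, `T` and the remaining vertices. -/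
lemma card_neighborFinset_le_dIn
    {V : Type*} [Fintype V] [DecidableEq V] (G : SimpleGraph V) [DecidableRel G.Adj]
    (a u : V) (S T : Finset V) :
    (G.neighborFinset u).card ≤
      1 + dIn G S u + dIn G ((Finset.univ \ insert a S) \ T) u + dIn G T u := by
  have hsub : G.neighborFinset u ⊆
      (({a} ∪ G.neighborFinset u ∩ S) ∪
        G.neighborFinset u ∩ ((Finset.univ \ insert a S) \ T)) ∪ G.neighborFinset u ∩ T := by
    intro w hw
    simp only [Finset.mem_union, Finset.mem_inter, Finset.mem_sdiff, Finset.mem_insert,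
      Finset.mem_univ, Finset.mem_singleton]
    tauto
  refine (Finset.card_le_card hsub).trans ((Finset.card_union_le _ _).trans ?_)
  refine Nat.add_le_add_right ((Finset.card_union_le _ _).trans ?_) _
  refine Nat.add_le_add_right ((Finset.card_union_le _ _).trans ?_) _
  simp [dIn]

/-- **Claim 2.2.** For `c ≥ 1` and `u ∈ U` with at most `cρ/4.5` neighbors in `W \\ W*` and having a neighbor `v₀ ∈ U` with `x_{v₀} ≤ x_u`, setting `λ = x_u / x_{u*}` we get `d_{W*}(u) ≥ (λ - c/4.5)ρ - (r + λ)`. -/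
theorem claim_2_2
    {V : Type*} [Fintype V] [DecidableEq V]
    (G : SimpleGraph V) [DecidableRel G.Adj] (hconn : G.Connected)
    (r : ℕ) (hr : 1 ≤ r)
    (hfree : ∀ u v, G.Adj u v → (G.neighborFinset u ∩ G.neighborFinset v).card ≤ r)
    (hm : 1 ≤ G.edgeFinset.card)
    (ρ : ℝ) (x : V → ℝ) (hx : ∀ v, 0 < x v)
    (heig : (G.adjMatrix ℝ).mulVec x = ρ • x)
    (ustar : V) (hustar : ∀ v, x v ≤ x ustar)
    (U W Wstar : Finset V)
    (hU : U = G.neighborFinset ustar)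
    (hW : W = Finset.univ \ insert ustar U)
    (hWstar : Wstar = W.filter (fun w => (1 - 4.5 * r / ρ) * x ustar ≤ x w))
    (c : ℝ) (hc : 1 ≤ c)
    (u : V) (hu : u ∈ U)
    (hudeg : (dIn G (W \ Wstar) u : ℝ) ≤ c * ρ / 4.5)
    (v₀ : V) (hv₀ : v₀ ∈ U) (huv₀ : G.Adj u v₀) (hxv₀ : x v₀ ≤ x u)
    :
    (dIn G Wstar u : ℝ) ≥
      (x u / x ustar - c / 4.5) * ρ - (r + x u / x ustar) := by
  have hpos := hx ustar
  have hdU : dIn G U u ≤ r := by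
    subst hU
    exact hfree u ustar (by simpa [SimpleGraph.adj_comm] using hu)
  have hcard := card_neighborFinset_le_dIn G ustar u U Wstar
  rw [← hW] at hcard
  have hcard' : ((G.neighborFinset u).card : ℝ) ≤
      1 + r + c * ρ / 4.5 + dIn G Wstar u := by
    have h₁ : ((G.neighborFinset u).card : ℝ) ≤
        1 + dIn G U u + dIn G (W \ Wstar) u + dIn G Wstar u := by exact_mod_cast hcard
    have h₂ : (dIn G U u : ℝ) ≤ r := by exact_mod_cast hdU
    linarith
  have hbound : ρ * x u ≤ (r + c * ρ / 4.5 + dIn G Wstar u) * x ustar + x u := by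
    have h₁ := eigenvalue_mul_le_of_adj G heig hustar huv₀
    have h₂ := mul_le_mul_of_nonneg_right hcard' hpos.le
    linarith
  have hdiv : ρ * (x u / x ustar) ≤ r + c * ρ / 4.5 + dIn G Wstar u + x u / x ustar := by
    refine le_of_mul_le_mul_right ?_ hpos
    rwa [mul_assoc, div_mul_cancel₀ _ hpos.ne', add_mul _ (x u / x ustar),
      div_mul_cancel₀ _ hpos.ne']
  have hexpand : (x u / x ustar - c / 4.5) * ρ = ρ * (x u / x ustar) - c * ρ / 4.5 := by ring
  rw [hexpand]
  linarith

end PerronSetup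
end
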